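/- arXiv:1701.01483 — 2 statements merged into one kernel-verified Lean document; each statement's English description precedes it below -/
import Mathlib

section
/- There is a universal constant C such that for every function f: ℝⁿ → [0,1] of bounded variation and every d ≥ 1, W^{≥d}[f] ≤ (C/√d)·E[|∇f|]. -/
open MeasureTheory ProbabilityTheory MvPolynomial
open scoped Classical

noncomputable section

namespace GaussNS

/-- The standard Gaussian measure `γ` on `ι → ℝ`. -/
def gaussianPi (ι : Type*) [Fintype ι] : Measure (ι → ℝ) :=
  Measure.pi fun _ => gaussianReal 0 1

/-- `Fin k` embedded as the standard basis vectors `e₁, …, e_k` of `ℝᵏ`. -/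
def basisVec {k : ℕ} (i : Fin k) : Fin k → ℝ := fun j => if j = i then 1 else 0

/-- The Ornstein–Uhlenbeck operator `P_t` acting on scalar functions:
`(P_t f)(x) = ∫ f(e^{-t} x + √(1-e^{-2t}) y) dγ(y)`. -/
def ouOp {ι : Type*} [Fintype ι] (t : ℝ) (f : (ι → ℝ) → ℝ) (x : ι → ℝ) : ℝ :=
  ∫ y, f (fun i => Real.exp (-t) * x i + Real.sqrt (1 - Real.exp (-2 * t)) * y i) ∂gaussianPi ι

/-- Noise stability `E⟨f, P_t f⟩` of a `[k]`-valued function on Gaussian space,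
where `f` is identified with a basis-vector-valued function. -/
def noiseStab {ι : Type*} [Fintype ι] {k : ℕ} (t : ℝ) (f : (ι → ℝ) → Fin k) : ℝ :=
  ∫ x, ∑ j, basisVec (f x) j * ouOp t (fun y => basisVec (f y) j) x ∂gaussianPi ι

/-- The mean vector `E[f] ∈ Δ_k` of a `[k]`-valued function. -/
def gMean {ι : Type*} [Fintype ι] {k : ℕ} (f : (ι → ℝ) → Fin k) : Fin k → ℝ :=
  fun j => ∫ x, basisVec (f x) j ∂gaussianPi ι

/-- The multivariate polynomial threshold function `PTF(p₁,…,p_k)`: value `j` if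
`p j > 0` and `p i ≤ 0` for all `i ≠ j`, and the first index otherwise. -/
def ptf {ι : Type*} {k : ℕ} [NeZero k] (p : Fin k → MvPolynomial ι ℝ) (x : ι → ℝ) : Fin k :=
  if h : ∃ j, 0 < eval x (p j) ∧ ∀ i, i ≠ j → eval x (p i) ≤ 0 then h.choose else 0

/-- Collision set of a multivariate PTF: points where the number of strictly
positive `p j` is not exactly one. -/
def collisionSet {ι : Type*} {k : ℕ} (p : Fin k → MvPolynomial ι ℝ) : Set (ι → ℝ) :=
  {x | ¬ ∃! j, 0 < eval x (p j)}

/-- Gaussian expectation of a polynomial. -/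
def gExp {ι : Type*} [Fintype ι] (p : MvPolynomial ι ℝ) : ℝ :=
  ∫ x, eval x p ∂gaussianPi ι

/-- Gaussian variance of a polynomial. -/
def gVar {ι : Type*} [Fintype ι] (p : MvPolynomial ι ℝ) : ℝ :=
  (∫ x, (eval x p) ^ 2 ∂gaussianPi ι) - gExp p ^ 2

/-- A family `p₁,…,p_k` of polynomials is `(d, δ)`-balanced if each `p i` has Gaussian
variance `1` and `|E[p i]| ≤ (log (k d / δ))^{d/2}`. -/
def balancedFam {ι : Type*} [Fintype ι] {k : ℕ} (d : ℕ) (δ : ℝ)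
    (p : Fin k → MvPolynomial ι ℝ) : Prop :=
  ∀ i, gVar (p i) = 1 ∧ |gExp (p i)| ≤ Real.log ((k : ℝ) * d / δ) ^ ((d : ℝ) / 2)

/-- The normalized multivariate Hermite polynomial `H_S(x) = ∏ i, H_{S i}(x i)/√(S i)!`. -/
def hermiteH {ι : Type*} [Fintype ι] (S : ι → ℕ) (x : ι → ℝ) : ℝ :=
  ∏ i, (Polynomial.aeval (x i) (Polynomial.hermite (S i)) / Real.sqrt (Nat.factorial (S i)))

/-- The Hermite coefficient `f̂(S) = E[f · H_S]`. -/
def hermCoeff {ι : Type*} [Fintype ι] (f : (ι → ℝ) → ℝ) (S : ι → ℕ) : ℝ :=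
  ∫ x, f x * hermiteH S x ∂gaussianPi ι

/-- Hermite weight `W^{>d}[f] = Σ_{|S| > d} ‖f̂(S)‖²` of a vector-valued function. -/
def wAbove {ι : Type*} [Fintype ι] {k : ℕ} (d : ℕ) (f : (ι → ℝ) → Fin k → ℝ) : ℝ :=
  ∑' S : ι → ℕ, if d < ∑ i, S i then ∑ j, hermCoeff (fun x => f x j) S ^ 2 else 0

/-- Hermite weight `W^{≥d}[f] = Σ_{|S| ≥ d} f̂(S)²` of a scalar function. -/
def wGE {ι : Type*} [Fintype ι] (d : ℕ) (f : (ι → ℝ) → ℝ) : ℝ :=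
  ∑' S : ι → ℕ, if d ≤ ∑ i, S i then hermCoeff f S ^ 2 else 0

/-- Squared `L²(γ)` norm `Σ_{|S| = q} f̂(S)²` of the projection of `f` onto
the `q`-th Wiener chaos. -/
def chaosNormSq {ι : Type*} [Fintype ι] (q : ℕ) (f : (ι → ℝ) → ℝ) : ℝ :=
  ∑' S : ι → ℕ, if (∑ i, S i) = q then hermCoeff f S ^ 2 else 0

/-- Frobenius norm of a tensor. -/
def frobNorm {α ι : Type*} [Fintype α] [Fintype ι] (T : (α → ι) → ℝ) : ℝ :=
  Real.sqrt (∑ t, T t ^ 2)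

/-- Contraction product `f ⊗_r g` of an order-`p` and an order-`q` tensor along `r`
indices, presented as a tensor in the remaining `(p-r)` and `(q-r)` indices. -/
def contr {ι : Type*} [Fintype ι] {p q r : ℕ} (hp : r ≤ p) (hq : r ≤ q)
    (f : (Fin p → ι) → ℝ) (g : (Fin q → ι) → ℝ)
    (a : Fin (p - r) → ι) (b : Fin (q - r) → ι) : ℝ :=
  ∑ z : Fin r → ι,
    f (fun i => Fin.append a z (Fin.cast (Nat.sub_add_cancel hp).symm i)) *
      g (fun i => Fin.append b z (Fin.cast (Nat.sub_add_cancel hq).symm i))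

/-- `λ_{S,S̄}(A)`: the largest singular value of the matricization of `A` along the
partition `(S, S̄)` of its index set. -/
def lamPart {ι : Type*} [Fintype ι] {q : ℕ} (A : (Fin q → ι) → ℝ) (S : Finset (Fin q)) : ℝ :=
  ⨆ g : ({i // i ∈ S} → ι) → ℝ, ⨆ h : ({i // i ∉ S} → ι) → ℝ,
    (∑ t : Fin q → ι, A t * g (fun i => t i.1) * h (fun i => t i.1)) /
      (frobNorm g * frobNorm h)

/-- `λ_max(A)`: maximum of `λ_{S,S̄}(A)` over nontrivial partitions `(S, S̄)`. -/
def lamMax {ι : Type*} [Fintype ι] {q : ℕ} (A : (Fin q → ι) → ℝ) : ℝ :=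
  ⨆ S : {S : Finset (Fin q) // S ≠ ∅ ∧ S ≠ Finset.univ}, lamPart A S.1

/-- The symmetric tensor `A_q` with `p = Σ_q I_q(A_q)` for a multilinear polynomial
(in terms of its Hermite coefficients). -/
def chaosTensor {ι : Type*} [Fintype ι] [DecidableEq ι] (f : (ι → ℝ) → ℝ) (q : ℕ) :
    (Fin q → ι) → ℝ :=
  fun t => if Function.Injective t then
      hermCoeff f (fun i => (Finset.univ.filter fun j => t j = i).card) / Real.sqrt (Nat.factorial q)
    else 0

/-- `λ_max(p) = max_{2 ≤ q ≤ deg p} λ_max(A_q)`. -/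
def polyLamMax {ι : Type*} [Fintype ι] [DecidableEq ι] (p : MvPolynomial ι ℝ) : ℝ :=
  ⨆ q : {q : ℕ // 2 ≤ q ∧ q ≤ p.totalDegree}, lamMax (chaosTensor (fun x => eval x p) q.1)

/-- A polynomial is `δ`-eigenregular if `λ_max(p) ≤ δ √(Var p)`. -/
def eigenregular {ι : Type*} [Fintype ι] [DecidableEq ι] (δ : ℝ) (p : MvPolynomial ι ℝ) : Prop :=
  polyLamMax p ≤ δ * Real.sqrt (gVar p)

/-- `p` lies in the `j`-th Wiener chaos `W^j`. -/
def inChaos {ι : Type*} [Fintype ι] (j : ℕ) (p : MvPolynomial ι ℝ) : Prop :=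
  ∀ S : ι → ℕ, (∑ i, S i) ≠ j → hermCoeff (fun x => eval x p) S = 0

/-- Expectation over the uniform measure on the hypercube `{-1,1}ⁿ ≃ Boolⁿ`. -/
def cubeE {n : ℕ} (g : (Fin n → Bool) → ℝ) : ℝ := (∑ x, g x) / 2 ^ n

/-- The Bonami–Beckner operator `T_ρ` on the hypercube. -/
def bbOp {n : ℕ} (ρ : ℝ) (g : (Fin n → Bool) → ℝ) (x : Fin n → Bool) : ℝ :=
  ∑ y : Fin n → Bool, (∏ i, if y i = x i then (1 + ρ) / 2 else (1 - ρ) / 2) * g y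

/-- Noise stability `E⟨f, T_ρ f⟩` on the hypercube of a `[k]`-valued function. -/
def cubeStab {n k : ℕ} (ρ : ℝ) (f : (Fin n → Bool) → Fin k) : ℝ :=
  cubeE fun x => ∑ j, basisVec (f x) j * bbOp ρ (fun y => basisVec (f y) j) x

/-- Influence of coordinate `i`: `Inf_i(f) = E_z[Var(f_{z,-i})]`, computed as
`E_x[‖f(x) - f(x^{⊕i})‖² / 4]`. -/
def influence {n k : ℕ} (i : Fin n) (f : (Fin n → Bool) → Fin k → ℝ) : ℝ :=
  cubeE fun x => (∑ j, (f x j - f (Function.update x i (!(x i))) j) ^ 2) / 4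

/-- `g ∈ T_z(F)`: `g` is a measurable rounding of `F` by thresholding at `z`, i.e.
`⟨e_{g(x)}, F(x) - z⟩ ≥ F_i(x) - z_i` for all `i` and `x`. -/
def memTz {ι : Type*} [Fintype ι] {k : ℕ} (z : Fin k → ℝ) (F : (ι → ℝ) → Fin k → ℝ)
    (g : (ι → ℝ) → Fin k) : Prop :=
  Measurable (fun x => basisVec (g x)) ∧ ∀ x i, F x i - z i ≤ F x (g x) - z (g x)

/-- `V` bounds the Gaussian total variation `E[|∇f|]` of `f`, characterized
distributionally: for every `C¹` compactly supported vector field `φ` with `‖φ‖ ≤ 1`,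
`∫ f · (div φ - ⟨x, φ⟩) dγ ≤ V`.  The least such `V` is `E[|∇f|]`. -/
def gaussTV {n : ℕ} (f : (Fin n → ℝ) → ℝ) (V : ℝ) : Prop :=
  ∀ φ : (Fin n → ℝ) → (Fin n → ℝ), ContDiff ℝ 1 φ → HasCompactSupport φ →
    (∀ x, Real.sqrt (∑ i, φ x i ^ 2) ≤ 1) →
    (∫ x, f x * ((∑ i, fderiv ℝ (fun y => φ y i) x (Pi.single i 1)) - ∑ i, x i * φ x i)
        ∂gaussianPi (Fin n)) ≤ V

/-- Evaluation of a polynomial at the noisy point `e^{-t} x + √(1-e^{-2t}) y`. -/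
def corrEval {m : ℕ} (t : ℝ) (p : MvPolynomial (Fin m) ℝ)
    (xy : (Fin m → ℝ) × (Fin m → ℝ)) : ℝ :=
  eval (fun i => Real.exp (-t) * xy.1 i + Real.sqrt (1 - Real.exp (-2 * t)) * xy.2 i) p

end GaussNS

namespace GaussNS

theorem integrable_gaussianReal_iff {u : ℝ → ℝ} :
    Integrable u (gaussianReal 0 1) ↔
      Integrable (fun x => gaussianPDFReal 0 1 x * u x) volume := by
  rw [gaussianReal_of_var_ne_zero 0 one_ne_zero,
    integrable_withDensity_iff_integrable_smul' (measurable_gaussianPDF 0 1)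
      (ae_of_all _ fun _ => gaussianPDF_lt_top)]
  simp [toReal_gaussianPDF]

theorem hasDerivAt_gaussianPDFReal (x : ℝ) :
    HasDerivAt (gaussianPDFReal 0 1) (-x * gaussianPDFReal 0 1 x) x := by
  have h : HasDerivAt (fun y : ℝ => -(y - 0) ^ 2 / (2 * ((1 : NNReal) : ℝ))) (-x) x := by
    have := (((hasDerivAt_id x).sub_const 0).pow 2).neg.div_const (2 * ((1 : NNReal) : ℝ))
    refine this.congr_deriv ?_
    simp
    ring
  have := h.exp.const_mul ((Real.sqrt (2 * Real.pi * ((1 : NNReal) : ℝ)))⁻¹)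
  rw [gaussianPDFReal_def]
  refine this.congr_deriv ?_
  simp only []
  ring

/-- Stein's identity for the standard Gaussian measure on the real line. -/
theorem integral_mul_gaussianReal {u u' : ℝ → ℝ} (hu : ∀ x, HasDerivAt u (u' x) x)
    (h0 : Integrable u (gaussianReal 0 1)) (h1 : Integrable u' (gaussianReal 0 1))
    (h2 : Integrable (fun x => x * u x) (gaussianReal 0 1)) :
    ∫ x, x * u x ∂gaussianReal 0 1 = ∫ x, u' x ∂gaussianReal 0 1 := by
  rw [integrable_gaussianReal_iff] at h0 h1 h2
  have key := integral_mul_deriv_eq_deriv_mul_of_integrable (u := gaussianPDFReal 0 1) (v := u)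
    (u' := fun x => -x * gaussianPDFReal 0 1 x) (v' := u')
    (fun x _ => hasDerivAt_gaussianPDFReal x) (fun x _ => hu x) h1
    (h2.neg.congr (ae_of_all _ fun x => by simp; ring)) h0
  rw [integral_gaussianReal_eq_integral_smul one_ne_zero,
    integral_gaussianReal_eq_integral_smul one_ne_zero]
  simp only [smul_eq_mul]
  rw [key, ← integral_neg]
  congr 1
  ext x
  ring

theorem integrable_polynomial_gaussianReal (p : Polynomial ℝ) :
    Integrable (fun x => p.eval x) (gaussianReal 0 1) := by
  induction p using Polynomial.induction_on' with
  | add p q hp hq => exact (hp.add hq).congr (ae_of_all _ fun x => by simp)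
  | monomial k a =>
    have := (memLp_id_gaussianReal (μ := 0) (v := 1) k).integrable_norm_pow'
    simp only [Polynomial.eval_monomial]
    refine Integrable.const_mul ?_ a
    refine this.mono' (by fun_prop) (ae_of_all _ fun x => by simp)

theorem integrable_gaussianReal_of_eval_eq {u : ℝ → ℝ} (p : Polynomial ℝ)
    (h : ∀ x, p.eval x = u x) : Integrable u (gaussianReal 0 1) :=
  (integrable_polynomial_gaussianReal p).congr (ae_of_all _ h)

theorem integral_X_mul_polynomial (p : Polynomial ℝ) :
    ∫ x, x * p.eval x ∂gaussianReal 0 1 = ∫ x, p.derivative.eval x ∂gaussianReal 0 1 :=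
  integral_mul_gaussianReal (fun x => p.hasDerivAt x) (integrable_polynomial_gaussianReal _)
    (integrable_polynomial_gaussianReal _)
    (integrable_gaussianReal_of_eval_eq (Polynomial.X * p) (by simp))

/-- The (probabilists') Hermite polynomial with real coefficients. -/
def hermiteR (n : ℕ) : Polynomial ℝ := (Polynomial.hermite n).map (Int.castRingHom ℝ)

theorem aeval_hermite (n : ℕ) (x : ℝ) :
    Polynomial.aeval x (Polynomial.hermite n) = (hermiteR n).eval x := by
  rw [hermiteR, Polynomial.eval_map, Polynomial.aeval_def]
  rfl

theorem hermiteR_zero : hermiteR 0 = 1 := by simp [hermiteR]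

theorem hermiteR_succ (n : ℕ) :
    hermiteR (n + 1) = Polynomial.X * hermiteR n - (hermiteR n).derivative := by
  simp [hermiteR, Polynomial.hermite_succ, Polynomial.derivative_map]

theorem derivative_hermiteR (n : ℕ) :
    (hermiteR (n + 1)).derivative = ((n : ℝ) + 1) • hermiteR n := by
  induction n with
  | zero => simp [hermiteR_succ, hermiteR_zero]
  | succ n ih =>
    rw [hermiteR_succ (n + 1), ih]
    simp only [Polynomial.derivative_sub, Polynomial.derivative_mul, Polynomial.derivative_X,
      ih, Polynomial.smul_eq_C_mul]
    rw [hermiteR_succ n]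
    simp only [map_add, map_one, map_natCast, Nat.cast_add, Nat.cast_one, Polynomial.derivative_one,
      Polynomial.derivative_natCast]
    ring

/-- One-dimensional Mehler identity: the noise operator acts diagonally on Hermite polynomials. -/
theorem integral_hermiteR_noise {c s : ℝ} (h : c ^ 2 + s ^ 2 = 1) (n : ℕ) (x : ℝ) :
    ∫ y, (hermiteR n).eval (c * x + s * y) ∂gaussianReal 0 1 = c ^ n * (hermiteR n).eval x := by
  have hInt : ∀ p : Polynomial ℝ,
      Integrable (fun y => p.eval (c * x + s * y)) (gaussianReal 0 1) := fun p =>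
    integrable_gaussianReal_of_eval_eq
      (p.comp (Polynomial.C (c * x) + Polynomial.C s * Polynomial.X)) (by simp)
  have hstein : ∀ p : Polynomial ℝ, ∫ y, y * p.eval (c * x + s * y) ∂gaussianReal 0 1
      = s * ∫ y, p.derivative.eval (c * x + s * y) ∂gaussianReal 0 1 := fun p => by
    have := integral_X_mul_polynomial
      (p.comp (Polynomial.C (c * x) + Polynomial.C s * Polynomial.X))
    simpa [Polynomial.eval_comp, Polynomial.derivative_comp, integral_const_mul] using this
  have hintX : ∀ p : Polynomial ℝ,
      Integrable (fun y => y * p.eval (c * x + s * y)) (gaussianReal 0 1) := fun p =>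
    integrable_gaussianReal_of_eval_eq
      (Polynomial.X * p.comp (Polynomial.C (c * x) + Polynomial.C s * Polynomial.X)) (by simp)
  have step : ∀ m : ℕ, ∫ y, (hermiteR (m + 1)).eval (c * x + s * y) ∂gaussianReal 0 1
      = c * x * (∫ y, (hermiteR m).eval (c * x + s * y) ∂gaussianReal 0 1)
        - c ^ 2 * ∫ y, (hermiteR m).derivative.eval (c * x + s * y) ∂gaussianReal 0 1 := by
    intro m
    have e : ∀ y, (hermiteR (m + 1)).eval (c * x + s * y)
        = c * x * (hermiteR m).eval (c * x + s * y)
          + s * (y * (hermiteR m).eval (c * x + s * y))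
          - (hermiteR m).derivative.eval (c * x + s * y) := fun y => by
      rw [hermiteR_succ]; simp; ring
    simp_rw [e]
    rw [integral_sub (Integrable.fun_add ((hInt _).const_mul _) ((hintX _).const_mul _)) (hInt _),
      integral_add ((hInt _).const_mul _) ((hintX _).const_mul _), integral_const_mul,
      integral_const_mul, hstein]
    have : s ^ 2 = 1 - c ^ 2 := by linarith
    linear_combination (∫ y, (hermiteR m).derivative.eval (c * x + s * y) ∂gaussianReal 0 1) * this
  induction n using Nat.strong_induction_on with
  | _ n ih =>
    match n with
    | 0 => simp [hermiteR_zero]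
    | 1 => rw [step 0]; simp [hermiteR_zero, hermiteR_succ]
    | m + 2 =>
      rw [step, derivative_hermiteR]
      simp only [Polynomial.eval_smul, smul_eq_mul, integral_const_mul]
      rw [ih (m + 1) (by omega), ih m (by omega), hermiteR_succ (m + 1), derivative_hermiteR]
      simp
      ring

/-- Orthogonality of the Hermite polynomials. -/
theorem integral_hermiteR_mul (m n : ℕ) :
    ∫ x, (hermiteR m).eval x * (hermiteR n).eval x ∂gaussianReal 0 1
      = if m = n then (n.factorial : ℝ) else 0 := by
  have step : ∀ (p : Polynomial ℝ) (m : ℕ),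
      ∫ x, (hermiteR (m + 1)).eval x * p.eval x ∂gaussianReal 0 1
        = ∫ x, (hermiteR m).eval x * p.derivative.eval x ∂gaussianReal 0 1 := by
    intro p m
    have h1 := integral_X_mul_polynomial (hermiteR m * p)
    have h2 : ∀ x, (hermiteR (m + 1)).eval x * p.eval x
        = x * (hermiteR m * p).eval x - ((hermiteR m).derivative * p).eval x := fun x => by
      rw [hermiteR_succ]; simp; ring
    simp_rw [h2]
    rw [integral_sub (integrable_gaussianReal_of_eval_eq
      (Polynomial.X * (hermiteR m * p)) (by simp)) (integrable_polynomial_gaussianReal _), h1,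
      ← integral_sub (integrable_polynomial_gaussianReal _)
        (integrable_polynomial_gaussianReal _)]
    congr 1
    ext x
    simp
  induction m generalizing n with
  | zero =>
    cases n with
    | zero => simp [hermiteR_zero]
    | succ n =>
      have := step 1 n
      simpa [hermiteR_zero] using this
  | succ m ih =>
    cases n with
    | zero => rw [step]; simp [hermiteR_zero]
    | succ n =>
      rw [step, derivative_hermiteR]
      simp only [Polynomial.eval_smul, smul_eq_mul, mul_left_comm, integral_const_mul, ih]
      by_cases h : m = n <;> simp [h, Nat.factorial_succ]

end GaussNS

namespace GaussNS

variable {ι : Type*} [Fintype ι]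

instance : IsGaussian (gaussianPi ι) := by
  rw [← isGaussian_map_equiv_iff (PiLp.continuousLinearEquiv 2 ℝ fun _ : ι => ℝ).symm]
  have h : (gaussianPi ι).map (PiLp.continuousLinearEquiv 2 ℝ fun _ : ι => ℝ).symm
      = stdGaussian (EuclideanSpace ℝ ι) := map_pi_eq_stdGaussian
  rw [h]
  infer_instance

/-- The law of a pair of independent standard Gaussian vectors. -/
abbrev gaussianPair (ι : Type*) [Fintype ι] : Measure ((ι → ℝ) × (ι → ℝ)) :=
  (gaussianPi ι).prod (gaussianPi ι)

theorem measurePreserving_eval_gaussianPi (i : ι) :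
    MeasurePreserving (Function.eval i) (gaussianPi ι) (gaussianReal 0 1) :=
  measurePreserving_eval (fun _ : ι => gaussianReal 0 1) i

theorem integral_id_gaussianPi : (gaussianPi ι)[id] = 0 := by
  have hInt : Integrable (id : (ι → ℝ) → ι → ℝ) (gaussianPi ι) := IsGaussian.integrable_id
  ext i
  have h := (ContinuousLinearMap.proj (R := ℝ) (φ := fun _ : ι => ℝ) i).integral_comp_comm hInt
  simp only [ContinuousLinearMap.proj_apply] at h
  rw [← h]
  have h3 := (measurePreserving_eval_gaussianPi i).map_eq
  have : ∫ x, x ∂(gaussianPi ι).map (Function.eval i) = ∫ x : ι → ℝ, x i ∂gaussianPi ι :=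
    integral_map (measurable_pi_apply i).aemeasurable (by fun_prop)
  simp only [id, ← this, h3, integral_id_gaussianReal, Pi.zero_apply]

theorem measurePreserving_rotation (θ : ℝ) :
    MeasurePreserving (ContinuousLinearMap.rotation θ) (gaussianPair ι) (gaussianPair ι) :=
  ⟨by fun_prop, IsGaussian.map_rotation_eq_self integral_id_gaussianPi θ⟩

theorem integral_comp_rotation (θ : ℝ) {F : (ι → ℝ) × (ι → ℝ) → ℝ}
    (hF : AEStronglyMeasurable F (gaussianPair ι)) :
    ∫ z, F (ContinuousLinearMap.rotation θ z) ∂gaussianPair ι = ∫ z, F z ∂gaussianPair ι := by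
  have h := (measurePreserving_rotation (ι := ι) θ)
  conv_rhs => rw [← h.map_eq]
  rw [integral_map h.measurable.aemeasurable (by rwa [h.map_eq])]

theorem hermiteH_eq (S : ι → ℕ) (x : ι → ℝ) :
    hermiteH S x = ∏ i, ((hermiteR (S i)).eval (x i) / Real.sqrt (Nat.factorial (S i))) := by
  simp only [hermiteH, aeval_hermite]

@[fun_prop]
theorem continuous_hermiteH (S : ι → ℕ) : Continuous (hermiteH S) := by
  have : hermiteH S = fun x : ι → ℝ =>
      ∏ i, ((hermiteR (S i)).eval (x i) / Real.sqrt (Nat.factorial (S i))) :=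
    funext (hermiteH_eq S)
  rw [this]
  fun_prop

theorem integral_hermiteH_mul (S T : ι → ℕ) :
    ∫ x, hermiteH S x * hermiteH T x ∂gaussianPi ι = if S = T then 1 else 0 := by
  simp only [hermiteH_eq, ← Finset.prod_mul_distrib, gaussianPi]
  rw [integral_fintype_prod_eq_prod (fun i t => (hermiteR (S i)).eval t /
    Real.sqrt (Nat.factorial (S i)) * ((hermiteR (T i)).eval t / Real.sqrt (Nat.factorial (T i))))]
  have h : ∀ i, ∫ t, (hermiteR (S i)).eval t / Real.sqrt (Nat.factorial (S i)) *
      ((hermiteR (T i)).eval t / Real.sqrt (Nat.factorial (T i))) ∂gaussianReal 0 1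
      = if S i = T i then 1 else 0 := by
    intro i
    simp_rw [div_mul_div_comm]
    rw [integral_div, integral_hermiteR_mul]
    split_ifs with h
    · rw [h, Real.mul_self_sqrt (Nat.cast_nonneg _), div_self]
      exact_mod_cast Nat.factorial_ne_zero _
    · simp
  simp_rw [h]
  by_cases hST : S = T
  · simp [hST]
  · obtain ⟨i, hi⟩ := Function.ne_iff.1 hST
    rw [if_neg hST]
    exact Finset.prod_eq_zero (Finset.mem_univ i) (if_neg hi)

theorem integrable_hermiteH_mul (S T : ι → ℕ) :
    Integrable (fun x => hermiteH S x * hermiteH T x) (gaussianPi ι) := by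
  simp only [hermiteH_eq, ← Finset.prod_mul_distrib, gaussianPi]
  refine Integrable.fintype_prod (f := fun i t => (hermiteR (S i)).eval t /
    Real.sqrt (Nat.factorial (S i)) * ((hermiteR (T i)).eval t / Real.sqrt (Nat.factorial (T i))))
    fun i => ?_
  refine ((integrable_gaussianReal_of_eval_eq (hermiteR (S i) * hermiteR (T i))
    (fun _ => rfl)).div_const
      (Real.sqrt (Nat.factorial (S i)) * Real.sqrt (Nat.factorial (T i)))).congr
    (ae_of_all _ fun t => ?_)
  simp [div_mul_div_comm]

theorem memLp_hermiteH (S : ι → ℕ) : MemLp (hermiteH S) 2 (gaussianPi ι) := by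
  rw [memLp_two_iff_integrable_sq (continuous_hermiteH S).aestronglyMeasurable]
  simpa only [sq] using integrable_hermiteH_mul S S

/-- Mehler identity: the noise operator acts diagonally on the Hermite basis. -/
theorem integral_hermiteH_noise {c s : ℝ} (h : c ^ 2 + s ^ 2 = 1) (S : ι → ℕ) (x : ι → ℝ) :
    ∫ y, hermiteH S (c • x + s • y) ∂gaussianPi ι = c ^ (∑ i, S i) * hermiteH S x := by
  simp only [hermiteH_eq, gaussianPi, Pi.add_apply, Pi.smul_apply, smul_eq_mul]
  rw [integral_fintype_prod_eq_prod (fun i t => (hermiteR (S i)).eval (c * x i + s * t) /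
    Real.sqrt (Nat.factorial (S i)))]
  simp_rw [integral_div, integral_hermiteR_noise h, mul_div_assoc, Finset.prod_mul_distrib,
    Finset.prod_pow_eq_pow_sum]

/-- First coordinate of a rotated pair: a vector correlated with the first one. -/
theorem rotation_fst (θ : ℝ) (z : (ι → ℝ) × (ι → ℝ)) :
    (ContinuousLinearMap.rotation θ z).1 = Real.cos θ • z.1 + Real.sin θ • z.2 := rfl

theorem rotation_rotation (θ τ : ℝ) (z : (ι → ℝ) × (ι → ℝ)) :
    ContinuousLinearMap.rotation θ (ContinuousLinearMap.rotation τ z)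
      = ContinuousLinearMap.rotation (θ + τ) z := by
  simp only [ContinuousLinearMap.rotation_apply, Real.cos_add, Real.sin_add]
  ext i <;> simp <;> ring

theorem rotation_zero (z : (ι → ℝ) × (ι → ℝ)) : ContinuousLinearMap.rotation 0 z = z := by
  simp [ContinuousLinearMap.rotation_apply]

theorem measurePreserving_fst_rotation (θ : ℝ) :
    MeasurePreserving (fun z => (ContinuousLinearMap.rotation θ z).1)
      (gaussianPair ι) (gaussianPi ι) :=
  (measurePreserving_fst (μ := gaussianPi ι) (ν := gaussianPi ι)).comp
    (measurePreserving_rotation θ)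

theorem integral_mul_hermiteH_rotation {u : (ι → ℝ) → ℝ} (hu : MemLp u 2 (gaussianPi ι))
    (θ : ℝ) (S : ι → ℕ) :
    ∫ z, u z.1 * hermiteH S (ContinuousLinearMap.rotation θ z).1 ∂gaussianPair ι
      = Real.cos θ ^ (∑ i, S i) * hermCoeff u S := by
  have hInt : Integrable (fun z => u z.1 * hermiteH S (ContinuousLinearMap.rotation θ z).1)
      (gaussianPair ι) :=
    (hu.comp_measurePreserving measurePreserving_fst).integrable_mul
      ((memLp_hermiteH S).comp_measurePreserving (measurePreserving_fst_rotation θ))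
  rw [integral_prod _ hInt]
  simp only [rotation_fst, integral_const_mul, hermCoeff]
  rw [← integral_const_mul]
  congr 1
  ext x
  rw [integral_hermiteH_noise (Real.cos_sq_add_sin_sq θ)]
  ring

theorem integral_diff_mul_diff_hermiteH {u : (ι → ℝ) → ℝ} (hu : MemLp u 2 (gaussianPi ι))
    (θ : ℝ) (S : ι → ℕ) :
    ∫ z, (u z.1 - u (ContinuousLinearMap.rotation θ z).1) *
        (hermiteH S z.1 - hermiteH S (ContinuousLinearMap.rotation θ z).1) ∂gaussianPair ι
      = 2 * (1 - Real.cos θ ^ (∑ i, S i)) * hermCoeff u S := by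
  have hfst := measurePreserving_fst (μ := gaussianPi ι) (ν := gaussianPi ι)
  have hrot := measurePreserving_fst_rotation (ι := ι) θ
  have u0 := hu.comp_measurePreserving hfst
  have u1 := hu.comp_measurePreserving hrot
  have v0 := (memLp_hermiteH S).comp_measurePreserving hfst
  have v1 := (memLp_hermiteH S).comp_measurePreserving hrot
  have e : ∀ z : (ι → ℝ) × (ι → ℝ), (u z.1 - u (ContinuousLinearMap.rotation θ z).1) *
        (hermiteH S z.1 - hermiteH S (ContinuousLinearMap.rotation θ z).1)
      = (u z.1 * hermiteH S z.1 + u (ContinuousLinearMap.rotation θ z).1 *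
          hermiteH S (ContinuousLinearMap.rotation θ z).1)
        - (u z.1 * hermiteH S (ContinuousLinearMap.rotation θ z).1
          + u (ContinuousLinearMap.rotation θ z).1 * hermiteH S z.1) := fun z => by ring
  have i00 : Integrable (fun z : (ι → ℝ) × (ι → ℝ) => u z.1 * hermiteH S z.1) (gaussianPair ι) :=
    u0.integrable_mul v0
  have i11 : Integrable (fun z : (ι → ℝ) × (ι → ℝ) => u (ContinuousLinearMap.rotation θ z).1 *
      hermiteH S (ContinuousLinearMap.rotation θ z).1) (gaussianPair ι) := u1.integrable_mul v1
  have i01 : Integrable (fun z : (ι → ℝ) × (ι → ℝ) => u z.1 *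
      hermiteH S (ContinuousLinearMap.rotation θ z).1) (gaussianPair ι) := u0.integrable_mul v1
  have i10 : Integrable (fun z : (ι → ℝ) × (ι → ℝ) => u (ContinuousLinearMap.rotation θ z).1 *
      hermiteH S z.1) (gaussianPair ι) := u1.integrable_mul v0
  have e00 : ∫ z, u z.1 * hermiteH S z.1 ∂gaussianPair ι = hermCoeff u S := by
    have := integral_mul_hermiteH_rotation hu 0 S
    simpa [rotation_zero] using this
  have e11 : ∫ z, u (ContinuousLinearMap.rotation θ z).1 *
      hermiteH S (ContinuousLinearMap.rotation θ z).1 ∂gaussianPair ι = hermCoeff u S := by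
    rw [← e00]
    exact integral_comp_rotation θ (F := fun z => u z.1 * hermiteH S z.1) i00.aestronglyMeasurable
  have e10 : ∫ z, u (ContinuousLinearMap.rotation θ z).1 * hermiteH S z.1 ∂gaussianPair ι
      = Real.cos θ ^ (∑ i, S i) * hermCoeff u S := by
    have h := integral_mul_hermiteH_rotation hu (-θ) S
    have hm : AEStronglyMeasurable (fun z : (ι → ℝ) × (ι → ℝ) => u z.1 *
        hermiteH S (ContinuousLinearMap.rotation (-θ) z).1) (gaussianPair ι) :=
      u0.aestronglyMeasurable.mul
        ((memLp_hermiteH S).comp_measurePreserving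
          (measurePreserving_fst_rotation (-θ))).aestronglyMeasurable
    rw [← integral_comp_rotation θ hm] at h
    simpa [rotation_rotation, rotation_zero] using h
  simp_rw [e]
  rw [integral_sub (i00.fun_add i11) (i01.fun_add i10), integral_add i00 i11, integral_add i01 i10,
    e00, e11, integral_mul_hermiteH_rotation hu, e10]
  ring

theorem sum_hermCoeff_sq_le {u : (ι → ℝ) → ℝ} (hu : MemLp u 2 (gaussianPi ι))
    (θ : ℝ) (F : Finset (ι → ℕ)) :
    ∑ S ∈ F, 2 * (1 - Real.cos θ ^ (∑ i, S i)) * hermCoeff u S ^ 2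
      ≤ ∫ z, (u z.1 - u (ContinuousLinearMap.rotation θ z).1) ^ 2 ∂gaussianPair ι := by
  set p : (ι → ℝ) → ℝ := fun x => ∑ S ∈ F, hermCoeff u S * hermiteH S x with hp
  have hpL : MemLp p 2 (gaussianPi ι) :=
    memLp_finsetSum F fun S _ => (memLp_hermiteH S).const_mul _
  have hcoeff : ∀ S ∈ F, hermCoeff p S = hermCoeff u S := by
    intro S hS
    simp only [hermCoeff, hp, Finset.sum_mul, mul_assoc]
    rw [integral_finsetSum _ fun T _ => (integrable_hermiteH_mul T S).const_mul _]
    simp only [integral_const_mul, integral_hermiteH_mul]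
    simp [hS]
  have hfst := measurePreserving_fst (μ := gaussianPi ι) (ν := gaussianPi ι)
  have hrot := measurePreserving_fst_rotation (ι := ι) θ
  have diffL : ∀ {v : (ι → ℝ) → ℝ}, MemLp v 2 (gaussianPi ι) →
      MemLp (fun z => v z.1 - v (ContinuousLinearMap.rotation θ z).1) 2 (gaussianPair ι) :=
    fun hv => (hv.comp_measurePreserving hfst).sub (hv.comp_measurePreserving hrot)
  have expand : ∀ {v : (ι → ℝ) → ℝ}, MemLp v 2 (gaussianPi ι) →
      ∫ z, (v z.1 - v (ContinuousLinearMap.rotation θ z).1) *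
        (p z.1 - p (ContinuousLinearMap.rotation θ z).1) ∂gaussianPair ι
      = ∑ S ∈ F, hermCoeff u S * (2 * (1 - Real.cos θ ^ (∑ i, S i)) * hermCoeff v S) := by
    intro v hv
    simp_rw [← integral_diff_mul_diff_hermiteH hv, ← integral_const_mul]
    rw [← integral_finsetSum]
    · congr 1
      ext z
      simp only [hp, ← Finset.sum_sub_distrib, Finset.mul_sum]
      exact Finset.sum_congr rfl fun S _ => by ring
    · intro S _
      exact ((diffL hv).integrable_mul (diffL (memLp_hermiteH S))).const_mul _
  have h1 := expand hu
  have h2 := expand hpL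
  have h3 : ∑ S ∈ F, hermCoeff u S * (2 * (1 - Real.cos θ ^ (∑ i, S i)) * hermCoeff p S)
      = ∑ S ∈ F, hermCoeff u S * (2 * (1 - Real.cos θ ^ (∑ i, S i)) * hermCoeff u S) :=
    Finset.sum_congr rfl fun S hS => by rw [hcoeff S hS]
  rw [h3] at h2
  have h4 : 0 ≤ ∫ z, ((u z.1 - u (ContinuousLinearMap.rotation θ z).1)
      - (p z.1 - p (ContinuousLinearMap.rotation θ z).1)) ^ 2 ∂gaussianPair ι :=
    integral_nonneg fun z => sq_nonneg _
  have e : ∀ z : (ι → ℝ) × (ι → ℝ), ((u z.1 - u (ContinuousLinearMap.rotation θ z).1)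
      - (p z.1 - p (ContinuousLinearMap.rotation θ z).1)) ^ 2
      = (u z.1 - u (ContinuousLinearMap.rotation θ z).1) ^ 2
        + (p z.1 - p (ContinuousLinearMap.rotation θ z).1) *
          (p z.1 - p (ContinuousLinearMap.rotation θ z).1)
        - 2 * ((u z.1 - u (ContinuousLinearMap.rotation θ z).1) *
          (p z.1 - p (ContinuousLinearMap.rotation θ z).1)) := fun z => by ring
  have iu : Integrable (fun z : (ι → ℝ) × (ι → ℝ) =>
      (u z.1 - u (ContinuousLinearMap.rotation θ z).1) ^ 2) (gaussianPair ι) :=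
    (diffL hu).integrable_sq
  have ip : Integrable (fun z : (ι → ℝ) × (ι → ℝ) =>
      (p z.1 - p (ContinuousLinearMap.rotation θ z).1) *
          (p z.1 - p (ContinuousLinearMap.rotation θ z).1)) (gaussianPair ι) :=
    (diffL hpL).integrable_mul (diffL hpL)
  have iup : Integrable (fun z : (ι → ℝ) × (ι → ℝ) =>
      2 * ((u z.1 - u (ContinuousLinearMap.rotation θ z).1) *
          (p z.1 - p (ContinuousLinearMap.rotation θ z).1))) (gaussianPair ι) :=
    ((diffL hu).integrable_mul (diffL hpL)).const_mul _
  simp_rw [e] at h4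
  rw [integral_sub (iu.fun_add ip) iup, integral_add iu ip, integral_const_mul, h1, h2] at h4
  have h5 : ∑ S ∈ F, 2 * (1 - Real.cos θ ^ (∑ i, S i)) * hermCoeff u S ^ 2
      = ∑ S ∈ F, hermCoeff u S * (2 * (1 - Real.cos θ ^ (∑ i, S i)) * hermCoeff u S) :=
    Finset.sum_congr rfl fun S _ => by ring
  linarith

end GaussNS

namespace GaussNS

theorem measurePreserving_insertNth_gaussianPi {n : ℕ} (i : Fin (n + 1)) :
    MeasurePreserving (MeasurableEquiv.piFinSuccAbove (fun _ => ℝ) i).symm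
      ((gaussianReal 0 1).prod (gaussianPi (Fin n))) (gaussianPi (Fin (n + 1))) :=
  (measurePreserving_piFinSuccAbove (fun _ : Fin (n + 1) => gaussianReal 0 1) i).symm

/-- Gaussian integration by parts (Stein's identity). -/
theorem integral_fderiv_single_gaussianPi {n : ℕ} (i : Fin n) {u : (Fin n → ℝ) → ℝ}
    (hu : ContDiff ℝ 1 u) (hc : HasCompactSupport u) :
    ∫ y, fderiv ℝ u y (Pi.single i 1) ∂gaussianPi (Fin n) = ∫ y, y i * u y ∂gaussianPi (Fin n) := by
  cases n with
  | zero => exact i.elim0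
  | succ m =>
    have hd : Continuous fun y => fderiv ℝ u y (Pi.single i 1) :=
      (hu.continuous_fderiv one_ne_zero).clm_apply continuous_const
    have hdc : HasCompactSupport fun y => fderiv ℝ u y (Pi.single i 1) := hc.fderiv_apply ℝ _
    have hm : Continuous fun y => y i * u y := by fun_prop
    have hmc : HasCompactSupport fun y => y i * u y := hc.mul_left
    have hp := measurePreserving_insertNth_gaussianPi i
    have fubini : ∀ v : (Fin (m + 1) → ℝ) → ℝ, Continuous v → HasCompactSupport v →
        ∫ y, v y ∂gaussianPi (Fin (m + 1)) =
          ∫ w, ∫ t, v (i.insertNth (α := fun _ => ℝ) t w) ∂gaussianReal 0 1 ∂gaussianPi (Fin m) := by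
      intro v hv hvc
      have hInt : Integrable v (gaussianPi (Fin (m + 1))) :=
        hv.integrable_of_hasCompactSupport hvc
      rw [← hp.integral_comp', integral_prod_symm]
      · rfl
      · exact hp.integrable_comp_of_integrable hInt
    have slice : ∀ v : (Fin (m + 1) → ℝ) → ℝ, Continuous v → HasCompactSupport v →
        ∀ w : Fin m → ℝ, Integrable (fun t => v (i.insertNth (α := fun _ => ℝ) t w))
          (gaussianReal 0 1) := by
      intro v hv hvc w
      obtain ⟨C, hC⟩ := hvc.exists_bound_of_continuous hv
      refine Integrable.of_bound (C := C) ?_ (ae_of_all _ fun t => hC _)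
      exact (hv.comp (by fun_prop)).aestronglyMeasurable
    rw [fubini _ hd hdc, fubini _ hm hmc]
    refine integral_congr_ae (ae_of_all _ fun w => ?_)
    have h1 : ∀ t : ℝ, HasDerivAt (fun t => u (i.insertNth (α := fun _ => ℝ) t w))
        (fderiv ℝ u (i.insertNth (α := fun _ => ℝ) t w) (Pi.single i 1)) t := by
      intro t
      have h2 := hasDerivAt_update (i.insertNth (α := fun _ => ℝ) 0 w) i t
      have h3 : ∀ t, Function.update (i.insertNth (α := fun _ => ℝ) 0 w) i t
          = i.insertNth (α := fun _ => ℝ) t w := fun t => Fin.update_insertNth _ _ _ _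
      have h4 := ((hu.differentiable one_ne_zero)
        (Function.update (i.insertNth (α := fun _ => ℝ) 0 w) i t)).hasFDerivAt.comp_hasDerivAt t h2
      simpa only [Function.comp_def, h3] using h4
    have h5 := integral_mul_gaussianReal h1 (slice u hu.continuous hc w) (slice _ hd hdc w)
      ((slice _ hm hmc w).congr (ae_of_all _ fun t => by simp))
    simp only [Fin.insertNth_apply_same]
    exact h5.symm

section Partial

variable {E F : Type*} [NormedAddCommGroup E] [NormedSpace ℝ E] [NormedAddCommGroup F]
  [NormedSpace ℝ F]

theorem hasFDerivAt_comp_prodMk_left {G : E × F → ℝ} (hG : ContDiff ℝ 1 G) (x : E) (y : F) :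
    HasFDerivAt (fun x => G (x, y)) ((fderiv ℝ G (x, y)).comp (ContinuousLinearMap.inl ℝ E F)) x :=
  ((hG.differentiable one_ne_zero) (x, y)).hasFDerivAt.comp x (hasFDerivAt_prodMk_left x y)

theorem hasFDerivAt_comp_prodMk_right {G : E × F → ℝ} (hG : ContDiff ℝ 1 G) (x : E) (y : F) :
    HasFDerivAt (fun y => G (x, y)) ((fderiv ℝ G (x, y)).comp (ContinuousLinearMap.inr ℝ E F)) y :=
  ((hG.differentiable one_ne_zero) (x, y)).hasFDerivAt.comp y (hasFDerivAt_prodMk_right x y)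

variable [MeasurableSpace F] [OpensMeasurableSpace F] [SecondCountableTopology F]
  {ν : Measure F} [IsFiniteMeasure ν]

theorem hasFDerivAt_integral_prodMk_left {G : E × F → ℝ} (hG : ContDiff ℝ 1 G)
    (hc : HasCompactSupport G) (x : E) :
    HasFDerivAt (fun x => ∫ y, G (x, y) ∂ν)
      (∫ y, (fderiv ℝ G (x, y)).comp (ContinuousLinearMap.inl ℝ E F) ∂ν) x := by
  have hd : Continuous fun z => (fderiv ℝ G z).comp (ContinuousLinearMap.inl ℝ E F) :=
    (hG.continuous_fderiv one_ne_zero).clm_comp continuous_const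
  have hdc : HasCompactSupport fun z => (fderiv ℝ G z).comp (ContinuousLinearMap.inl ℝ E F) :=
    (hc.fderiv (𝕜 := ℝ)).comp_left
      (g := fun L : E × F →L[ℝ] ℝ => L.comp (ContinuousLinearMap.inl ℝ E F))
      (ContinuousLinearMap.zero_comp _)
  obtain ⟨C, hC⟩ := hdc.exists_bound_of_continuous hd
  obtain ⟨C', hC'⟩ := hc.exists_bound_of_continuous hG.continuous
  have hm : ∀ x, AEStronglyMeasurable (fun y => G (x, y)) ν := fun x =>
    (hG.continuous.comp (by fun_prop)).aestronglyMeasurable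
  exact hasFDerivAt_integral_of_dominated_of_fderiv_le (s := Set.univ) (bound := fun _ => C)
    Filter.univ_mem (Filter.Eventually.of_forall hm)
    (Integrable.of_bound (hm x) C' (ae_of_all _ fun y => hC' _))
    (hd.comp (Continuous.prodMk_right x)).aestronglyMeasurable
    (ae_of_all _ fun y x _ => hC (x, y)) (integrable_const C)
    (ae_of_all _ fun y x _ => hasFDerivAt_comp_prodMk_left hG x y)

theorem contDiff_integral_prodMk_left {G : E × F → ℝ} (hG : ContDiff ℝ 1 G)
    (hc : HasCompactSupport G) : ContDiff ℝ 1 (fun x => ∫ y, G (x, y) ∂ν) := by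
  have hd : Continuous fun z => (fderiv ℝ G z).comp (ContinuousLinearMap.inl ℝ E F) :=
    (hG.continuous_fderiv one_ne_zero).clm_comp continuous_const
  have hdc : HasCompactSupport fun z => (fderiv ℝ G z).comp (ContinuousLinearMap.inl ℝ E F) :=
    (hc.fderiv (𝕜 := ℝ)).comp_left
      (g := fun L : E × F →L[ℝ] ℝ => L.comp (ContinuousLinearMap.inl ℝ E F))
      (ContinuousLinearMap.zero_comp _)
  obtain ⟨C, hC⟩ := hdc.exists_bound_of_continuous hd
  refine contDiff_one_iff_fderiv.2
    ⟨fun x => (hasFDerivAt_integral_prodMk_left hG hc x).differentiableAt, ?_⟩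
  have he : (fderiv ℝ fun x => ∫ y, G (x, y) ∂ν) =
      fun x => ∫ y, (fderiv ℝ G (x, y)).comp (ContinuousLinearMap.inl ℝ E F) ∂ν :=
    funext fun x => (hasFDerivAt_integral_prodMk_left hG hc x).fderiv
  rw [he]
  exact continuous_of_dominated (bound := fun _ => C)
    (fun x => (hd.comp (Continuous.prodMk_right x)).aestronglyMeasurable)
    (fun x => ae_of_all _ fun y => hC (x, y)) (integrable_const C)
    (ae_of_all _ fun y => hd.comp (Continuous.prodMk_left y))

theorem fderiv_integral_prodMk_left {G : E × F → ℝ} (hG : ContDiff ℝ 1 G)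
    (hc : HasCompactSupport G) (x v : E) :
    fderiv ℝ (fun x => ∫ y, G (x, y) ∂ν) x v = ∫ y, fderiv ℝ G (x, y) (v, 0) ∂ν := by
  have hd : Continuous fun z => (fderiv ℝ G z).comp (ContinuousLinearMap.inl ℝ E F) :=
    (hG.continuous_fderiv one_ne_zero).clm_comp continuous_const
  have hdc : HasCompactSupport fun z => (fderiv ℝ G z).comp (ContinuousLinearMap.inl ℝ E F) :=
    (hc.fderiv (𝕜 := ℝ)).comp_left
      (g := fun L : E × F →L[ℝ] ℝ => L.comp (ContinuousLinearMap.inl ℝ E F))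
      (ContinuousLinearMap.zero_comp _)
  obtain ⟨C, hC⟩ := hdc.exists_bound_of_continuous hd
  rw [(hasFDerivAt_integral_prodMk_left hG hc x).fderiv, ContinuousLinearMap.integral_apply]
  · simp
  · exact Integrable.of_bound (hd.comp (Continuous.prodMk_right x)).aestronglyMeasurable C
      (ae_of_all _ fun y => hC (x, y))

end Partial

theorem hasCompactSupport_slice_right {n : ℕ} {β : Type*} [Zero β]
    {G : (Fin n → ℝ) × (Fin n → ℝ) → β} (hc : HasCompactSupport G) (x : Fin n → ℝ) :
    HasCompactSupport fun y => G (x, y) :=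
  HasCompactSupport.intro (hc.isCompact.image continuous_snd) fun y hy => by
    by_contra h
    exact hy ⟨(x, y), subset_tsupport _ h, rfl⟩

theorem integral_eval_mul_eval_gaussianPi {ι : Type*} [Fintype ι] (i j : ι) :
    ∫ y : ι → ℝ, y i * y j ∂gaussianPi ι = if i = j then 1 else 0 := by
  have h : ∀ (i : ι) (y : ι → ℝ), hermiteH (Pi.single i 1) y = y i := by
    intro i y
    rw [hermiteH, Finset.prod_eq_single i]
    · simp
    · intro k _ hk
      simp [Pi.single_eq_of_ne hk]
    · simp
  have h1 := integral_hermiteH_mul (Pi.single i 1 : ι → ℕ) (Pi.single j 1)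
  simp only [h] at h1
  rw [h1]
  refine if_congr ⟨fun h2 => ?_, fun h2 => by rw [h2]⟩ rfl rfl
  by_contra h3
  have := congrFun h2 i
  simp [Pi.single_eq_of_ne h3] at this

theorem memLp_eval_gaussianPi {ι : Type*} [Fintype ι] (i : ι) :
    MemLp (fun y : ι → ℝ => y i) 2 (gaussianPi ι) :=
  (memLp_id_gaussianReal 2).comp_measurePreserving (measurePreserving_eval_gaussianPi i)

theorem integral_sq_sum_mul_gaussianPi {ι : Type*} [Fintype ι] (a : ι → ℝ) :
    ∫ y : ι → ℝ, (∑ i, a i * y i) ^ 2 ∂gaussianPi ι = ∑ i, a i ^ 2 := by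
  have hi : ∀ i j, Integrable (fun y : ι → ℝ => a i * a j * (y i * y j)) (gaussianPi ι) :=
    fun i j => ((memLp_eval_gaussianPi i).integrable_mul (memLp_eval_gaussianPi j)).const_mul _
  have h : ∀ y : ι → ℝ, (∑ i, a i * y i) ^ 2 = ∑ i, ∑ j, a i * a j * (y i * y j) := by
    intro y
    rw [sq, Finset.sum_mul_sum]
    exact Finset.sum_congr rfl fun i _ => Finset.sum_congr rfl fun j _ => by ring
  simp_rw [h]
  rw [integral_finsetSum _ fun i _ => integrable_finsetSum _ fun j _ => hi i j]
  refine Finset.sum_congr rfl fun i _ => ?_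
  rw [integral_finsetSum _ fun j _ => hi i j]
  simp [integral_const_mul, integral_eval_mul_eval_gaussianPi, sq]

theorem sum_integral_mul_sq_le_one {ι : Type*} [Fintype ι] {g : (ι → ℝ) → ℝ}
    (hg : AEStronglyMeasurable g (gaussianPi ι)) (hb : ∀ y, |g y| ≤ 1) :
    ∑ i, (∫ y, y i * g y ∂gaussianPi ι) ^ 2 ≤ 1 := by
  have hgi : ∀ {v : (ι → ℝ) → ℝ}, Integrable v (gaussianPi ι) →
      Integrable (fun y => v y * g y) (gaussianPi ι) := fun hv =>
    hv.mul_bdd hg (ae_of_all _ hb)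
  have hL : ∀ a : ι → ℝ, MemLp (fun y : ι → ℝ => ∑ i, a i * y i) 2 (gaussianPi ι) := fun a =>
    memLp_finsetSum _ fun i _ => (memLp_eval_gaussianPi i).const_mul _
  set a : ι → ℝ := fun i => ∫ y, y i * g y ∂gaussianPi ι with ha
  have hInt : ∀ i, Integrable (fun y : ι → ℝ => y i) (gaussianPi ι) := fun i =>
    (memLp_eval_gaussianPi i).integrable one_le_two
  have h1 : ∑ i, a i ^ 2 = ∫ y, (∑ i, a i * y i) * g y ∂gaussianPi ι := by
    simp_rw [Finset.sum_mul, mul_assoc]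
    rw [integral_finsetSum _ fun i _ => (hgi (hInt i)).const_mul _]
    simp [integral_const_mul, sq, ha]
  have h2 : ∫ y, (∑ i, a i * y i) * g y ∂gaussianPi ι
      ≤ ∫ y, ((∑ i, a i * y i) ^ 2 + 1) / 2 ∂gaussianPi ι := by
    refine integral_mono (hgi ((hL a).integrable one_le_two))
      (((hL a).integrable_sq.add (integrable_const 1)).div_const 2) fun y => ?_
    have := abs_le.1 (hb y)
    have h3 : (g y) ^ 2 ≤ 1 := by nlinarith
    simp only
    nlinarith [sq_nonneg ((∑ i, a i * y i) - g y)]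
  rw [integral_div, integral_add (hL a).integrable_sq (integrable_const 1),
    integral_sq_sum_mul_gaussianPi] at h2
  simp only [integral_const, probReal_univ, smul_eq_mul, mul_one] at h2
  linarith

end GaussNS

namespace GaussNS

variable {n : ℕ}

theorem contDiff_snd_mul {h : (Fin n → ℝ) × (Fin n → ℝ) → ℝ} (hh : ContDiff ℝ 1 h) (i : Fin n) :
    ContDiff ℝ 1 fun z => z.2 i * h z := by
  have : ContDiff ℝ 1 fun z : (Fin n → ℝ) × (Fin n → ℝ) => z.2 i :=
    (contDiff_apply ℝ ℝ i).comp contDiff_snd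
  exact this.mul hh

theorem fderiv_snd_mul {h : (Fin n → ℝ) × (Fin n → ℝ) → ℝ} (hh : ContDiff ℝ 1 h) (i : Fin n)
    (z : (Fin n → ℝ) × (Fin n → ℝ)) (v : Fin n → ℝ) :
    fderiv ℝ (fun z => z.2 i * h z) z (v, 0) = z.2 i * fderiv ℝ h z (v, 0) := by
  have h1 : HasFDerivAt (fun z : (Fin n → ℝ) × (Fin n → ℝ) => z.2 i)
      ((ContinuousLinearMap.proj (R := ℝ) (φ := fun _ : Fin n => ℝ) i).comp
        (ContinuousLinearMap.snd ℝ (Fin n → ℝ) (Fin n → ℝ))) z :=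
    (((ContinuousLinearMap.proj (R := ℝ) (φ := fun _ : Fin n => ℝ) i).comp
        (ContinuousLinearMap.snd ℝ (Fin n → ℝ) (Fin n → ℝ)))).hasFDerivAt
  have h2 := ((hh.differentiable one_ne_zero) z).hasFDerivAt
  rw [(h1.fun_mul h2).fderiv]
  simp

theorem clm_apply_eq_sum (L : (Fin n → ℝ) →L[ℝ] ℝ) (v : Fin n → ℝ) :
    L v = ∑ i, v i * L (Pi.single i 1) := by
  conv_lhs => rw [pi_eq_sum_univ' v, map_sum]
  exact Finset.sum_congr rfl fun i _ => by
    rw [map_smul, smul_eq_mul]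

/-- Testing the total variation of `f` against the derivative of `h` along the generator
`(x, y) ↦ (y, -x)` of rotations. -/
theorem integral_mul_fderiv_rotation_le {f : (Fin n → ℝ) → ℝ} (hf : Measurable f)
    (hf01 : ∀ x, f x ∈ Set.Icc (0 : ℝ) 1) {V : ℝ} (hV : gaussTV f V)
    {h : (Fin n → ℝ) × (Fin n → ℝ) → ℝ} (hh : ContDiff ℝ 1 h) (hc : HasCompactSupport h)
    (hb : ∀ z, |h z| ≤ 1) :
    ∫ z, f z.1 * fderiv ℝ h z (z.2, -z.1) ∂gaussianPair (Fin n) ≤ V := by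
  have hG : ∀ i, ContDiff ℝ 1 fun z => z.2 i * h z := contDiff_snd_mul hh
  have hGc : ∀ i, HasCompactSupport fun z => z.2 i * h z := fun i => hc.mul_left
  have hd := hh.continuous_fderiv one_ne_zero
  have hdc : HasCompactSupport (fderiv ℝ h) := hc.fderiv (𝕜 := ℝ)
  have hfield := hV (fun x i => ∫ y, y i * h (x, y) ∂gaussianPi (Fin n))
    (contDiff_pi.2 fun i => contDiff_integral_prodMk_left (hG i) (hGc i))
    (HasCompactSupport.intro (hc.isCompact.image continuous_fst) fun x hx => by
      have : ∀ y, h (x, y) = 0 := fun y => by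
        by_contra h0
        exact hx ⟨(x, y), subset_tsupport _ h0, rfl⟩
      ext i
      simp [this])
    (fun x => by
      refine Real.sqrt_le_one.2 ?_
      exact sum_integral_mul_sq_le_one
        (hh.continuous.comp (Continuous.prodMk_right x)).aestronglyMeasurable fun y => hb (x, y))
  refine le_of_eq_of_le ?_ hfield
  -- the total derivative along `(y, -x)` is bounded and continuous
  have hJ : Continuous fun z : (Fin n → ℝ) × (Fin n → ℝ) => fderiv ℝ h z (z.2, -z.1) :=
    hd.clm_apply (by fun_prop)
  have hJc : HasCompactSupport
      fun z : (Fin n → ℝ) × (Fin n → ℝ) => fderiv ℝ h z (z.2, -z.1) :=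
    HasCompactSupport.intro hdc fun z hz => by simp [image_eq_zero_of_notMem_tsupport hz]
  have hInt : Integrable (fun z : (Fin n → ℝ) × (Fin n → ℝ) =>
      f z.1 * fderiv ℝ h z (z.2, -z.1)) (gaussianPair (Fin n)) :=
    (hJ.integrable_of_hasCompactSupport hJc).bdd_mul
      (hf.comp measurable_fst).aestronglyMeasurable
      (ae_of_all _ fun z => by
        rw [Real.norm_eq_abs, abs_of_nonneg (hf01 _).1]
        exact (hf01 _).2)
  rw [integral_prod _ hInt]
  refine integral_congr_ae (ae_of_all _ fun x => ?_)
  simp only [integral_const_mul]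
  congr 1
  have hx1 : ∀ i, Integrable (fun y => y i * fderiv ℝ h (x, y) (Pi.single i 1, 0))
      (gaussianPi (Fin n)) := fun i => by
    refine Continuous.integrable_of_hasCompactSupport ?_ ?_
    · exact (continuous_apply i).mul
        ((hd.comp (Continuous.prodMk_right x)).clm_apply continuous_const)
    · exact HasCompactSupport.mul_left ((hasCompactSupport_slice_right hdc x).comp_left
        (g := fun L : (Fin n → ℝ) × (Fin n → ℝ) →L[ℝ] ℝ => L (Pi.single i 1, 0)) rfl)
  have hx2 : ∀ i, Integrable (fun y => fderiv ℝ h (x, y) (0, Pi.single i 1))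
      (gaussianPi (Fin n)) := fun i => by
    refine Continuous.integrable_of_hasCompactSupport ?_ ?_
    · exact (hd.comp (Continuous.prodMk_right x)).clm_apply continuous_const
    · exact (hasCompactSupport_slice_right hdc x).comp_left
        (g := fun L : (Fin n → ℝ) × (Fin n → ℝ) →L[ℝ] ℝ => L (0, Pi.single i 1)) rfl
  have split : ∀ y, fderiv ℝ h (x, y) (y, -x) =
      (∑ i, y i * fderiv ℝ h (x, y) (Pi.single i 1, 0))
        - ∑ i, x i * fderiv ℝ h (x, y) (0, Pi.single i 1) := by
    intro y
    have e1 := clm_apply_eq_sum ((fderiv ℝ h (x, y)).comp (ContinuousLinearMap.inl ℝ _ _)) y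
    have e2 := clm_apply_eq_sum ((fderiv ℝ h (x, y)).comp (ContinuousLinearMap.inr ℝ _ _)) x
    simp only [ContinuousLinearMap.comp_apply, ContinuousLinearMap.inl_apply,
      ContinuousLinearMap.inr_apply] at e1 e2
    rw [← e1, ← e2, ← map_sub]
    simp
  have stein : ∀ i, ∫ y, fderiv ℝ h (x, y) (0, Pi.single i 1) ∂gaussianPi (Fin n)
      = ∫ y, y i * h (x, y) ∂gaussianPi (Fin n) := by
    intro i
    refine Eq.trans ?_ (integral_fderiv_single_gaussianPi i (hh.comp (contDiff_prodMk_right x))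
      (hasCompactSupport_slice_right hc x))
    refine integral_congr_ae (ae_of_all _ fun y => ?_)
    have := (hasFDerivAt_comp_prodMk_right hh x y).fderiv
    simp only [this, ContinuousLinearMap.comp_apply,
      ContinuousLinearMap.inr_apply]
  simp_rw [split]
  rw [integral_sub (integrable_finsetSum _ fun i _ => hx1 i)
    (integrable_finsetSum _ fun i _ => (hx2 i).const_mul _),
    integral_finsetSum _ fun i _ => hx1 i,
    integral_finsetSum _ fun i _ => (hx2 i).const_mul _]
  simp only [integral_const_mul, stein]
  congr 1
  refine Finset.sum_congr rfl fun i _ => ?_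
  rw [fderiv_integral_prodMk_left (hG i) (hGc i)]
  simp only [fderiv_snd_mul hh]

end GaussNS

namespace GaussNS

variable {n : ℕ}

theorem hasDerivAt_rotation (τ : ℝ) (z : (Fin n → ℝ) × (Fin n → ℝ)) :
    HasDerivAt (fun τ => ContinuousLinearMap.rotation τ z)
      ((ContinuousLinearMap.rotation τ z).2, -(ContinuousLinearMap.rotation τ z).1) τ := by
  simp only [ContinuousLinearMap.rotation_apply]
  refine HasDerivAt.prodMk ?_ ?_
  · exact ((Real.hasDerivAt_cos τ).smul_const z.1).add ((Real.hasDerivAt_sin τ).smul_const z.2)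
  · refine (((Real.hasDerivAt_sin τ).fun_neg.smul_const z.1).add
      ((Real.hasDerivAt_cos τ).smul_const z.2)).congr_deriv ?_
    simp only [neg_add, neg_smul]

theorem rotation_generator (τ : ℝ) (z : (Fin n → ℝ) × (Fin n → ℝ)) :
    ContinuousLinearMap.rotation τ (z.2, -z.1)
      = ((ContinuousLinearMap.rotation τ z).2, -(ContinuousLinearMap.rotation τ z).1) := by
  simp only [ContinuousLinearMap.rotation_apply]
  ext i <;> simp
  ring

theorem hasCompactSupport_comp_rotation {h : (Fin n → ℝ) × (Fin n → ℝ) → ℝ}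
    (hc : HasCompactSupport h) (τ : ℝ) :
    HasCompactSupport fun z => h (ContinuousLinearMap.rotation τ z) :=
  HasCompactSupport.intro
    (hc.isCompact.image (ContinuousLinearMap.rotation (E := Fin n → ℝ) (-τ)).continuous)
    fun z hz => by
      by_contra h0
      refine hz ⟨_, subset_tsupport _ h0, ?_⟩
      rw [rotation_rotation, neg_add_cancel, rotation_zero]

/-- Rotating the pair `(x, y)` by the angle `θ` changes `f x` by at most `θ V`, tested against
functions bounded by one. -/
theorem integral_sub_rotation_mul_le {f : (Fin n → ℝ) → ℝ} (hf : Measurable f)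
    (hf01 : ∀ x, f x ∈ Set.Icc (0 : ℝ) 1) {V : ℝ} (hV : gaussTV f V)
    {h : (Fin n → ℝ) × (Fin n → ℝ) → ℝ} (hh : ContDiff ℝ 1 h) (hc : HasCompactSupport h)
    (hb : ∀ z, |h z| ≤ 1) {θ : ℝ} (hθ : 0 ≤ θ) :
    ∫ z, (f z.1 - f (ContinuousLinearMap.rotation θ z).1) * h z ∂gaussianPair (Fin n) ≤ θ * V := by
  have hfb : ∀ x, ‖f x‖ ≤ 1 := fun x => by
    rw [Real.norm_eq_abs, abs_of_nonneg (hf01 _).1]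
    exact (hf01 _).2
  have hfm : AEStronglyMeasurable (fun z : (Fin n → ℝ) × (Fin n → ℝ) => f z.1)
      (gaussianPair (Fin n)) := (hf.comp measurable_fst).aestronglyMeasurable
  have hrc : ∀ τ, Continuous fun z : (Fin n → ℝ) × (Fin n → ℝ) =>
      h (ContinuousLinearMap.rotation τ z) := fun τ =>
    hh.continuous.comp (ContinuousLinearMap.rotation τ).continuous
  have hInt : ∀ τ, Integrable (fun z : (Fin n → ℝ) × (Fin n → ℝ) =>
      f z.1 * h (ContinuousLinearMap.rotation τ z)) (gaussianPair (Fin n)) := fun τ =>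
    ((hrc τ).integrable_of_hasCompactSupport (hasCompactSupport_comp_rotation hc τ)).bdd_mul
      hfm (ae_of_all _ fun z => hfb _)
  set g : (Fin n → ℝ) × (Fin n → ℝ) → ℝ := fun z => fderiv ℝ h z (z.2, -z.1) with hg
  have hgc : Continuous g := (hh.continuous_fderiv one_ne_zero).clm_apply (by fun_prop)
  have hgs : HasCompactSupport g :=
    HasCompactSupport.intro (hc.fderiv (𝕜 := ℝ)) fun z hz => by
      simp [hg, image_eq_zero_of_notMem_tsupport hz]
  obtain ⟨C, hC⟩ := hgs.exists_bound_of_continuous hgc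
  have hderiv : ∀ τ, HasDerivAt
      (fun τ => ∫ z, f z.1 * h (ContinuousLinearMap.rotation τ z) ∂gaussianPair (Fin n))
      (∫ z, f z.1 * g (ContinuousLinearMap.rotation τ z) ∂gaussianPair (Fin n)) τ := by
    intro τ
    refine (hasDerivAt_integral_of_dominated_loc_of_deriv_le
      (F' := fun τ z => f z.1 * g (ContinuousLinearMap.rotation τ z)) (s := Set.univ) (bound := fun _ => C)
      Filter.univ_mem (Filter.Eventually.of_forall fun τ => (hInt τ).aestronglyMeasurable)
      (hInt τ) (hfm.mul
        (hgc.comp (ContinuousLinearMap.rotation τ).continuous).aestronglyMeasurable)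
      (ae_of_all _ fun z t _ => ?_) (integrable_const C) (ae_of_all _ fun z t _ => ?_)).2
    · rw [norm_mul]
      calc _ ≤ 1 * C := mul_le_mul (hfb _) (hC _) (norm_nonneg _) zero_le_one
        _ = C := one_mul C
    · exact (((hh.differentiable one_ne_zero)
        (ContinuousLinearMap.rotation t z)).hasFDerivAt.comp_hasDerivAt t
          (hasDerivAt_rotation t z)).const_mul _
  have hle : ∀ τ, ∫ z, f z.1 * g (ContinuousLinearMap.rotation τ z) ∂gaussianPair (Fin n) ≤ V := by
    intro τ
    have h1 := integral_mul_fderiv_rotation_le hf hf01 hV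
      (hh.comp (ContinuousLinearMap.rotation (E := Fin n → ℝ) τ).contDiff)
      (hasCompactSupport_comp_rotation hc τ) fun z => hb _
    refine le_of_eq_of_le (integral_congr_ae (ae_of_all _ fun z => ?_)) h1
    have h2 := ((hh.differentiable one_ne_zero)
        (ContinuousLinearMap.rotation τ z)).hasFDerivAt.comp z
          (ContinuousLinearMap.rotation (E := Fin n → ℝ) τ).hasFDerivAt
    simp only [h2.fderiv, ContinuousLinearMap.comp_apply, rotation_generator, hg]
  have hmv := image_sub_le_mul_sub_of_deriv_le (fun τ => (hderiv τ).differentiableAt)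
    (fun τ => (hderiv τ).deriv.trans_le (hle τ)) (neg_nonpos.2 hθ)
  simp only [rotation_zero, zero_sub, neg_neg] at hmv
  have hrot := integral_comp_rotation θ (hInt (-θ)).aestronglyMeasurable
  simp only [rotation_rotation, neg_add_cancel, rotation_zero] at hrot
  have hi1 : Integrable (fun z : (Fin n → ℝ) × (Fin n → ℝ) => f z.1 * h z)
      (gaussianPair (Fin n)) := by
    simpa only [rotation_zero] using hInt 0
  have hi2 : Integrable (fun z : (Fin n → ℝ) × (Fin n → ℝ) =>
      f (ContinuousLinearMap.rotation θ z).1 * h z) (gaussianPair (Fin n)) :=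
    (hh.continuous.integrable_of_hasCompactSupport hc).bdd_mul
      (hf.comp (measurePreserving_fst_rotation θ).measurable).aestronglyMeasurable
      (ae_of_all _ fun z => hfb _)
  simp_rw [sub_mul]
  rw [integral_sub hi1 hi2, hrot]
  linarith

end GaussNS

namespace GaussNS

variable {n : ℕ}

theorem sq_le_two_mul_mul_sin {x : ℝ} (hx : |x| ≤ 1) : x ^ 2 ≤ 2 * (x * Real.sin x) := by
  wlog h0 : 0 ≤ x generalizing x
  · have := this (x := -x) (by rwa [abs_neg]) (by linarith)
    rw [Real.sin_neg] at this
    linarith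
  rw [abs_of_nonneg h0] at hx
  have h1 := Real.mul_le_sin h0 (by linarith [Real.pi_gt_three])
  have h2 : x / 2 ≤ 2 / Real.pi * x := by
    have : (1 : ℝ) / 2 ≤ 2 / Real.pi := by
      rw [div_le_div_iff₀ two_pos Real.pi_pos]
      linarith [Real.pi_le_four]
    nlinarith
  nlinarith

/-- The rotation of angle `θ` moves `f` by at most `2 θ V` in mean square. -/
theorem integral_sub_rotation_sq_le {f : (Fin n → ℝ) → ℝ} (hf : Measurable f)
    (hf01 : ∀ x, f x ∈ Set.Icc (0 : ℝ) 1) {V : ℝ} (hV : gaussTV f V) {θ : ℝ} (hθ : 0 ≤ θ) :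
    ∫ z, (f z.1 - f (ContinuousLinearMap.rotation θ z).1) ^ 2 ∂gaussianPair (Fin n)
      ≤ 2 * (θ * V) := by
  set F : (Fin n → ℝ) × (Fin n → ℝ) → ℝ :=
    fun z => f z.1 - f (ContinuousLinearMap.rotation θ z).1 with hF
  have hFm : Measurable F := (hf.comp measurable_fst).sub
    (hf.comp (measurePreserving_fst_rotation θ).measurable)
  have hFb : ∀ z, |F z| ≤ 1 := fun z => by
    have h1 := hf01 z.1
    have h2 := hf01 (ContinuousLinearMap.rotation θ z).1
    exact abs_le.2 ⟨by linarith [h1.1, h2.2], by linarith [h1.2, h2.1]⟩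
  have hFi : Integrable F (gaussianPair (Fin n)) :=
    Integrable.of_bound hFm.aestronglyMeasurable 1 (ae_of_all _ hFb)
  refine le_of_forall_pos_le_add fun ε hε => ?_
  obtain ⟨g, hgs, hgc, hg⟩ := (memLp_one_iff_integrable.2 hFi).exist_eLpNorm_sub_le
    ENNReal.one_ne_top le_rfl (half_pos hε)
  have hgi : Integrable g (gaussianPair (Fin n)) :=
    hgc.continuous.integrable_of_hasCompactSupport hgs
  have hdist : ∫ z, |F z - g z| ∂gaussianPair (Fin n) ≤ ε / 2 := by
    have h1 := integral_norm_eq_lintegral_enorm (hFi.sub hgi).aestronglyMeasurable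
    rw [← eLpNorm_one_eq_lintegral_enorm] at h1
    refine le_of_eq_of_le h1 ?_
    exact ENNReal.toReal_le_of_le_ofReal (half_pos hε).le hg
  have htest := integral_sub_rotation_mul_le hf hf01 hV
    (h := fun z => Real.sin (g z)) (Real.contDiff_sin.comp (hgc.of_le (by exact_mod_cast le_top)))
    (hgs.comp_left Real.sin_zero) (fun z => Real.abs_sin_le_one _) hθ
  have hsi : Integrable (fun z => F z * Real.sin (g z)) (gaussianPair (Fin n)) :=
    hFi.mul_bdd (Real.continuous_sin.comp hgc.continuous).aestronglyMeasurable
      (ae_of_all _ fun z => Real.abs_sin_le_one _)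
  have hai : Integrable (fun z => |F z - g z|) (gaussianPair (Fin n)) := (hFi.sub hgi).abs
  have hmono : ∫ z, F z ^ 2 ∂gaussianPair (Fin n)
      ≤ ∫ z, 2 * (F z * Real.sin (g z) + |F z - g z|) ∂gaussianPair (Fin n) := by
    refine integral_mono ?_ ((hsi.add hai).const_mul 2) fun z => ?_
    · exact (MemLp.of_bound hFm.aestronglyMeasurable 1 (ae_of_all _ hFb)).integrable_sq
    · have h1 := sq_le_two_mul_mul_sin (hFb z)
      have h2 : |Real.sin (F z) - Real.sin (g z)| ≤ |F z - g z| := by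
        simpa [Real.dist_eq] using Real.lipschitzWith_sin.dist_le_mul (F z) (g z)
      have h3 : F z * (Real.sin (F z) - Real.sin (g z)) ≤ |F z - g z| :=
        calc _ ≤ |F z * (Real.sin (F z) - Real.sin (g z))| := le_abs_self _
          _ = |F z| * |Real.sin (F z) - Real.sin (g z)| := abs_mul _ _
          _ ≤ 1 * |F z - g z| := mul_le_mul (hFb z) h2 (abs_nonneg _) zero_le_one
          _ = _ := one_mul _
      simp only
      nlinarith
  rw [integral_const_mul, integral_add hsi hai] at hmono
  linarith

theorem gaussTV.nonneg {f : (Fin n → ℝ) → ℝ} {V : ℝ} (hV : gaussTV f V) : 0 ≤ V := by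
  have h := hV 0 contDiff_const HasCompactSupport.zero (by simp)
  simpa using h

theorem one_sub_cos_pow_ge {d k : ℕ} (hd : 1 ≤ d) (hk : d ≤ k) :
    1 / 4 ≤ 1 - Real.cos (1 / Real.sqrt d) ^ k := by
  have hd0 : (1 : ℝ) ≤ d := by exact_mod_cast hd
  have hs1 : 1 ≤ Real.sqrt d := Real.one_le_sqrt.2 hd0
  have hs0 : 0 < Real.sqrt d := by linarith
  set θ := 1 / Real.sqrt d with hθ
  have hθ0 : 0 < θ := by positivity
  have hθ1 : θ ≤ 1 := by rw [hθ, div_le_one hs0]; exact hs1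
  have hθd : θ ^ 2 * d = 1 := by
    rw [hθ, div_pow, Real.sq_sqrt (by linarith)]
    field_simp
  have hc0 : 0 ≤ Real.cos θ :=
    Real.cos_nonneg_of_neg_pi_div_two_le_of_le (by linarith [Real.pi_gt_three])
      (by linarith [Real.pi_gt_three])
  have h1 : Real.cos θ ^ k ≤ Real.cos θ ^ d := pow_le_pow_of_le_one hc0 (Real.cos_le_one _) hk
  have h2 := Real.cos_le_one_div_sqrt_sq_add_one (x := θ) (by linarith [Real.pi_gt_three])
    (by linarith [Real.pi_gt_three])
  have h3 : Real.cos θ ^ 2 ≤ (θ ^ 2 + 1)⁻¹ := by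
    have := pow_le_pow_left₀ hc0 h2 2
    rwa [div_pow, Real.sq_sqrt (by positivity), one_pow, one_div] at this
  have h4 : (Real.cos θ ^ d) ^ 2 ≤ 1 / 2 := by
    have hb : (2 : ℝ) ≤ (θ ^ 2 + 1) ^ d := by
      have := one_add_mul_le_pow (a := θ ^ 2) (by nlinarith) d
      rw [add_comm (θ ^ 2)]
      linarith
    rw [← pow_mul, mul_comm d 2, pow_mul]
    refine (pow_le_pow_left₀ (sq_nonneg _) h3 d).trans ?_
    rw [inv_pow, one_div]
    exact inv_anti₀ two_pos hb
  nlinarith [pow_nonneg hc0 d]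

end GaussNS

open GaussNS

/-- There is a universal constant `C` such that for every `[0,1]`-valued
function `f` of bounded variation and every `d ≥ 1`,
`W^{≥ d}[f] ≤ (C/√d) · E[|∇f|]`  (where `E[|∇f|]` is the Gaussian total variation,
characterized as the least `V` with `gaussTV f V`). -/
theorem stmt6 :
    ∃ C : ℝ, 0 < C ∧ ∀ (n d : ℕ), 1 ≤ d → ∀ f : (Fin n → ℝ) → ℝ,
      Measurable f → (∀ x, f x ∈ Set.Icc (0 : ℝ) 1) →
      ∀ V : ℝ, gaussTV f V → wGE d f ≤ C / Real.sqrt d * V := by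
  refine ⟨4, four_pos, fun n d hd f hf hf01 V hV => ?_⟩
  have hu : MemLp f 2 (gaussianPi (Fin n)) :=
    MemLp.of_bound hf.aestronglyMeasurable 1 (ae_of_all _ fun x => by
      rw [Real.norm_eq_abs, abs_of_nonneg (hf01 _).1]
      exact (hf01 _).2)
  have hV0 := hV.nonneg
  refine tsum_le_of_sum_le' (by positivity) fun F => ?_
  have h1 := (sum_hermCoeff_sq_le hu (1 / Real.sqrt d) F).trans
    (integral_sub_rotation_sq_le hf hf01 hV (by positivity))
  have h2 : ∑ S ∈ F, 1 / 2 * (if d ≤ ∑ i, S i then hermCoeff f S ^ 2 else 0)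
      ≤ ∑ S ∈ F, 2 * (1 - Real.cos (1 / Real.sqrt d) ^ (∑ i, S i)) * hermCoeff f S ^ 2 := by
    refine Finset.sum_le_sum fun S _ => ?_
    split_ifs with hS
    · have := one_sub_cos_pow_ge hd hS
      exact mul_le_mul_of_nonneg_right (by linarith) (sq_nonneg _)
    · have h3 : Real.cos (1 / Real.sqrt d) ^ (∑ i, S i) ≤ 1 :=
        (le_abs_self _).trans (by
          rw [abs_pow]
          exact pow_le_one₀ (abs_nonneg _) (Real.abs_cos_le_one _))
      rw [mul_zero]
      exact mul_nonneg (by linarith) (sq_nonneg _)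
  rw [← Finset.mul_sum] at h2
  have h4 : 4 / Real.sqrt d * V = 2 * (2 * (1 / Real.sqrt d * V)) := by ring
  linarith
end
end

section
/- Take measurable f: ℝⁿ → Δ_k, g: ℝⁿ → {e₁,…,e_k}, and z ∈ ℝᵏ. Suppose that whenever g(x) = e_i we have i ∈ argmax{f_j(x) − z_j : j = 1,…,k}. Then g maximizes E[⟨f, h⟩] among all measurable h: ℝⁿ → {e₁,…,e_k} satisfying E[h] = E[g]; that is, E[⟨f, g⟩] ≥ E[⟨f, h⟩] for all such h. -/
open MeasureTheory ProbabilityTheory MvPolynomial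
open scoped Classical

noncomputable section

open GaussNS

instance {ι : Type*} [Fintype ι] : IsProbabilityMeasure (gaussianPi ι) := by
  unfold gaussianPi
  infer_instance

theorem sum_mul_basisVec {k : ℕ} (u : Fin k → ℝ) (i : Fin k) :
    ∑ j, u j * basisVec i j = u i := by
  simp [basisVec]

theorem abs_basisVec_le_one {k : ℕ} (i j : Fin k) : |basisVec i j| ≤ 1 := by
  unfold basisVec
  split_ifs <;> simp

theorem integrable_mul_basisVec {ι : Type*} [Fintype ι] {k : ℕ} {u : (ι → ℝ) → ℝ}
    (hu : Integrable u (gaussianPi ι)) {h : (ι → ℝ) → Fin k}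
    (hh : Measurable fun x => basisVec (h x)) (j : Fin k) :
    Integrable (fun x => u x * basisVec (h x) j) (gaussianPi ι) :=
  hu.mul_bdd (c := 1) (measurable_pi_iff.1 hh j).aestronglyMeasurable
    (Filter.Eventually.of_forall fun x => abs_basisVec_le_one (h x) j)

theorem integral_sum_mul_basisVec_eq {ι : Type*} [Fintype ι] {k : ℕ} (z : Fin k → ℝ)
    {h : (ι → ℝ) → Fin k} (hh : Measurable fun x => basisVec (h x)) :
    ∫ x, ∑ j, z j * basisVec (h x) j ∂gaussianPi ι = ∑ j, z j * gMean h j := by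
  rw [integral_finsetSum _ fun j _ => integrable_mul_basisVec (integrable_const (z j)) hh j]
  simp only [integral_const_mul, gMean]

/-- If `g(x) = e_i` only when `i` maximizes `f_j(x) - z_j`, then `g`
maximizes `E⟨f, h⟩` among all `h : ℝⁿ → {e₁,…,e_k}` with `E[h] = E[g]`. -/
theorem stmt7 {n k : ℕ} (f : (Fin n → ℝ) → Fin k → ℝ) (hf : Measurable f)
    (hsimplex : ∀ x, (∀ j, 0 ≤ f x j) ∧ (∑ j, f x j) = 1)
    (g : (Fin n → ℝ) → Fin k) (hg : Measurable fun x => basisVec (g x))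
    (z : Fin k → ℝ)
    (hargmax : ∀ x j, f x j - z j ≤ f x (g x) - z (g x)) :
    ∀ h : (Fin n → ℝ) → Fin k, Measurable (fun x => basisVec (h x)) →
      (∀ j, gMean h j = gMean g j) →
      (∫ x, ∑ j, f x j * basisVec (h x) j ∂gaussianPi (Fin n)) ≤
        ∫ x, ∑ j, f x j * basisVec (g x) j ∂gaussianPi (Fin n) := by
  intro h hh hmean
  have hint (j : Fin k) : Integrable (fun x => f x j) (gaussianPi (Fin n)) := by
    refine Integrable.of_bound (measurable_pi_iff.1 hf j).aestronglyMeasurable 1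
      (Filter.Eventually.of_forall fun x => ?_)
    rw [Real.norm_of_nonneg ((hsimplex x).1 j), ← (hsimplex x).2]
    exact Finset.single_le_sum (fun i _ => (hsimplex x).1 i) (Finset.mem_univ j)
  have hF {w : (Fin n → ℝ) → Fin k} (hw : Measurable fun x => basisVec (w x)) :
      Integrable (fun x => ∑ j, f x j * basisVec (w x) j) (gaussianPi (Fin n)) :=
    integrable_finsetSum _ fun j _ => integrable_mul_basisVec (hint j) hw j
  have hZ {w : (Fin n → ℝ) → Fin k} (hw : Measurable fun x => basisVec (w x)) :
      Integrable (fun x => ∑ j, z j * basisVec (w x) j) (gaussianPi (Fin n)) :=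
    integrable_finsetSum _ fun j _ => integrable_mul_basisVec (integrable_const (z j)) hw j
  have hz : ∫ x, ∑ j, z j * basisVec (h x) j ∂gaussianPi (Fin n) =
      ∫ x, ∑ j, z j * basisVec (g x) j ∂gaussianPi (Fin n) := by
    simp only [integral_sum_mul_basisVec_eq z hh, integral_sum_mul_basisVec_eq z hg, hmean]
  have hle := integral_mono ((hF hh).sub (hZ hh)) ((hF hg).sub (hZ hg)) fun x => by
    simpa only [Pi.sub_apply, sum_mul_basisVec] using hargmax x (h x)
  rw [integral_sub' (hF hh) (hZ hh), integral_sub' (hF hg) (hZ hg), hz] at hle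
  exact (sub_le_sub_iff_right _).1 hle
end
end
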